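/- Suppose gamma G is a unitary reflection coset in V = C^n and zeta is a complex root of unity. Then there is a long exact sequence of ZG-modules ... -> H~_n(S'_zeta^V(gamma G)) -> H~_n(T'_zeta^V(gamma G)) -> H~_n(U'_zeta^V(gamma G)) -> H~_{n-1}(S'_zeta^V(gamma G)) -> ..., where the first two maps are induced by the inclusions and the connecting map is the Mayer–Vietoris connecting map for the extension P = S'_zeta^V(gamma G) of Q = T'_zeta^V(gamma G) with P_Q = U'_zeta^V(gamma G). -/

import Mathlib

/-! Ordered chains, the augmented simplicial chain complex of the order complex of a poset
(given by an arbitrary strict-order relation), reduced homology, and induced maps. -/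

/-- Ordered chains with `n` vertices with respect to a relation `r`
(the `(n-1)`-simplices of the order complex). -/
def OCh (α : Type*) (r : α → α → Prop) (n : ℕ) : Type _ :=
  {f : Fin n → α // ∀ ⦃i j : Fin n⦄, i < j → r (f i) (f j)}

/-- The augmented simplicial chain group with `n`-vertex chains as basis
(`n = 0` gives the augmentation degree `-1`). -/
abbrev ACh (α : Type*) (r : α → α → Prop) (n : ℕ) := OCh α r n →₀ ℤ

/-- The `i`-th face of an `(n+1)`-vertex ordered chain. -/
def OCh.face {α : Type*} {r : α → α → Prop} {n : ℕ} (c : OCh α r (n + 1)) (i : Fin (n + 1)) :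
    OCh α r n :=
  ⟨c.1 ∘ i.succAbove, fun _ _ h => c.2 (Fin.strictMono_succAbove i h)⟩

/-- The simplicial boundary map of the augmented chain complex. -/
noncomputable def bdry (α : Type*) (r : α → α → Prop) (n : ℕ) :
    ACh α r (n + 1) →ₗ[ℤ] ACh α r n :=
  Finsupp.lsum ℤ fun c => LinearMap.toSpanSingleton ℤ _
    (∑ i : Fin (n + 1), ((-1 : ℤ) ^ (i : ℕ)) • Finsupp.single (c.face i) (1 : ℤ))

/-- Augmented `n`-cycles (chains with `n+1` vertices). -/
noncomputable def cyc (α : Type*) (r : α → α → Prop) (n : ℕ) :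
    Submodule ℤ (ACh α r (n + 1)) := LinearMap.ker (bdry α r n)

/-- Augmented `n`-boundaries (chains with `n+1` vertices). -/
noncomputable def bdries (α : Type*) (r : α → α → Prop) (n : ℕ) :
    Submodule ℤ (ACh α r (n + 1)) := LinearMap.range (bdry α r (n + 1))

/-- Reduced simplicial homology `H̃ₙ` (over `ℤ`) of the order complex of `(α, r)`. -/
noncomputable abbrev redH (α : Type*) (r : α → α → Prop) (n : ℕ) :=
  cyc α r n ⧸ (bdries α r n).comap (cyc α r n).subtype

/-- Reduced homology in degree `-1`. -/
noncomputable abbrev redHneg (α : Type*) (r : α → α → Prop) :=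
  (⊤ : Submodule ℤ (ACh α r 0)) ⧸
    (LinearMap.range (bdry α r 0)).comap (⊤ : Submodule ℤ (ACh α r 0)).subtype

section maps

variable {α β : Type*} {rα : α → α → Prop} {rβ : β → β → Prop}

/-- The simplicial map on ordered chains induced by a relation-preserving map. -/
def cmap (f : α → β) (hf : ∀ ⦃a b⦄, rα a b → rβ (f a) (f b)) {n : ℕ} (c : OCh α rα n) :
    OCh β rβ n :=
  ⟨f ∘ c.1, fun _ _ h => hf (c.2 h)⟩

/-- The induced map on augmented chain groups. -/
noncomputable def cmapL (f : α → β) (hf : ∀ ⦃a b⦄, rα a b → rβ (f a) (f b)) (n : ℕ) :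
    ACh α rα n →ₗ[ℤ] ACh β rβ n :=
  Finsupp.lmapDomain ℤ ℤ (cmap f hf)

theorem bdry_single {n : ℕ} (c : OCh α rα (n + 1)) (b : ℤ) :
    bdry α rα n (Finsupp.single c b) =
      b • ∑ i : Fin (n + 1), ((-1 : ℤ) ^ (i : ℕ)) • Finsupp.single (c.face i) (1 : ℤ) := by
  simp [bdry, Finsupp.lsum_single, LinearMap.toSpanSingleton_apply]

theorem face_cmap (f : α → β) (hf : ∀ ⦃a b⦄, rα a b → rβ (f a) (f b)) {n : ℕ}
    (c : OCh α rα (n + 1)) (i : Fin (n + 1)) :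
    (cmap f hf c).face i = cmap f hf (c.face i) := rfl

/-- Naturality of the boundary map. -/
theorem bdry_cmapL (f : α → β) (hf : ∀ ⦃a b⦄, rα a b → rβ (f a) (f b)) (n : ℕ) :
    (bdry β rβ n).comp (cmapL f hf (n + 1)) = (cmapL f hf n).comp (bdry α rα n) := by
  refine Finsupp.lhom_ext fun c b => ?_
  simp only [LinearMap.comp_apply, cmapL, Finsupp.lmapDomain_apply, Finsupp.mapDomain_single,
    bdry_single]
  rw [← Finsupp.lmapDomain_apply ℤ ℤ (cmap f hf), map_smul, map_sum]
  simp [Finsupp.lmapDomain_apply, Finsupp.mapDomain_single, face_cmap]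

theorem cmapL_mem_cyc (f : α → β) (hf : ∀ ⦃a b⦄, rα a b → rβ (f a) (f b)) {n : ℕ}
    {z : ACh α rα (n + 1)} (hz : z ∈ cyc α rα n) :
    cmapL f hf (n + 1) z ∈ cyc β rβ n := by
  have := congrArg (fun φ : ACh α rα (n+1) →ₗ[ℤ] ACh β rβ n => φ z) (bdry_cmapL f hf n)
  simp only [LinearMap.comp_apply] at this
  simp only [cyc, LinearMap.mem_ker] at hz ⊢
  rw [this, hz, map_zero]

/-- The induced map on reduced homology of a relation-preserving map. -/
noncomputable def indH (f : α → β) (hf : ∀ ⦃a b⦄, rα a b → rβ (f a) (f b)) (n : ℕ) :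
    redH α rα n →ₗ[ℤ] redH β rβ n :=
  Submodule.mapQ _ _
    ((cmapL f hf (n + 1)).restrict (fun _ hz => cmapL_mem_cyc f hf hz))
    (by
      rintro ⟨z, hz⟩ hmem
      simp only [Submodule.mem_comap, bdries, LinearMap.mem_range] at hmem ⊢
      obtain ⟨w, hw⟩ := hmem
      refine ⟨cmapL f hf (n + 2) w, ?_⟩
      have := congrArg (fun φ : ACh α rα (n+2) →ₗ[ℤ] ACh β rβ (n+1) => φ w) (bdry_cmapL f hf (n+1))
      simp only [LinearMap.comp_apply] at this
      simp only [LinearMap.restrict_apply]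
      rw [this, hw]
      rfl)

/-- The induced map on reduced homology in degree `-1`. -/
noncomputable def indHneg (f : α → β) (hf : ∀ ⦃a b⦄, rα a b → rβ (f a) (f b)) :
    redHneg α rα →ₗ[ℤ] redHneg β rβ :=
  Submodule.mapQ _ _ ((cmapL f hf 0).restrict (fun _ _ => Submodule.mem_top))
    (by
      rintro ⟨z, hz⟩ hmem
      simp only [Submodule.mem_comap, LinearMap.mem_range] at hmem ⊢
      obtain ⟨w, hw⟩ := hmem
      refine ⟨cmapL f hf 1 w, ?_⟩
      have := congrArg (fun φ : ACh α rα 1 →ₗ[ℤ] ACh β rβ 0 => φ w) (bdry_cmapL f hf 0)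
      simp only [LinearMap.comp_apply] at this
      simp only [LinearMap.restrict_apply]
      rw [this, hw]
      rfl)

/-- Coning off chains with a new bottom vertex `b`. -/
def coneMap (f : α → β) (hf : ∀ ⦃a b⦄, rα a b → rβ (f a) (f b)) (b : β)
    (hb : ∀ a : α, rβ b (f a)) {n : ℕ} (c : OCh α rα n) : OCh β rβ (n + 1) :=
  ⟨Fin.cons b (f ∘ c.1), by
    intro i j hij
    rcases Fin.eq_zero_or_eq_succ j with hj | ⟨j', rfl⟩
    · subst hj; exact absurd hij (Fin.not_lt_zero i)
    · rcases Fin.eq_zero_or_eq_succ i with hi | ⟨i', rfl⟩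
      · subst hi; simpa using hb (c.1 j')
      · have h' : i' < j' := by simpa using hij
        simpa using hf (c.2 h')⟩

/-- The linear extension of `coneMap` to chain groups: `z ↦ b * z`. -/
noncomputable def coneL (f : α → β) (hf : ∀ ⦃a b⦄, rα a b → rβ (f a) (f b)) (b : β)
    (hb : ∀ a : α, rβ b (f a)) (n : ℕ) : ACh α rα n →ₗ[ℤ] ACh β rβ (n + 1) :=
  Finsupp.lmapDomain ℤ ℤ (coneMap f hf b hb)

end maps

section PosetConstructions

/-- The strict order of the poset `P_Q` on `Option P`, where `none` plays the role of the
adjoined minimal element `0̂_Q` lying below exactly the elements of `Q`. -/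
def extRel {P : Type*} (rP : P → P → Prop) (Q : Set P) : Option P → Option P → Prop
  | some x, some y => rP x y
  | none, some y => y ∈ Q
  | _, none => False

/-- The strict order of the poset suspension `Σ R` on `Bool ⊕ R`; `Sum.inl false` and
`Sum.inl true` are the two adjoined elements `0̂_R` and `0̂'_R`, lying below every element
of `R` and incomparable with each other. -/
def suspRel {R : Type*} (rR : R → R → Prop) : Bool ⊕ R → Bool ⊕ R → Prop
  | Sum.inl _, Sum.inr _ => True
  | Sum.inr a, Sum.inr b => rR a b
  | _, _ => False

/-- The underlying set of the wedge of suspensions `⋁_{t ∈ T} Σ Rₜ`: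
`none` is the adjoined minimal element `0̂`, `some (Sum.inl t)` is the element `t ∈ T`, and
`some (Sum.inr ⟨t, x⟩)` is the element `(x, t) ∈ Rₜ × {t}`. -/
abbrev WedgeP (T : Type*) (R : T → Type*) := Option (T ⊕ Σ t, R t)

/-- The strict order of the wedge of suspensions of the posets `Rₜ`. -/
def wRel {T : Type*} {R : T → Type*} (r : ∀ t, R t → R t → Prop) :
    WedgeP T R → WedgeP T R → Prop
  | none, some (Sum.inr _) => True
  | some (Sum.inl t), some (Sum.inr b) => t = b.1
  | some (Sum.inr a), some (Sum.inr b) => ∃ h : a.1 = b.1, r b.1 (h ▸ a.2) b.2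
  | _, _ => False

/-- The order complex of `(α, r)` restricted to the vertex set `S`: the abstract simplicial
complex whose simplices are the finite chains contained in `S`. -/
def cpx (α : Type*) (r : α → α → Prop) (S : Set α) : Set (Finset α) :=
  {s | ↑s ⊆ S ∧ ∀ a ∈ s, ∀ b ∈ s, a ≠ b → r a b ∨ r b a}

/-- The full order complex of `(α, r)`. -/
abbrev fullCpx (α : Type*) (r : α → α → Prop) : Set (Finset α) := cpx α r Set.univ

theorem empty_mem_cpx (α : Type*) (r : α → α → Prop) (S : Set α) : ∅ ∈ cpx α r S := by
  simp [cpx]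

/-- The length of the poset `(α, r)`: the supremum of the lengths of its chains. -/
noncomputable def posetLength (α : Type*) (r : α → α → Prop) : ℕ :=
  sSup {k : ℕ | Nonempty {f : Fin (k+1) → α // ∀ ⦃i j : Fin (k+1)⦄, i < j → r (f i) (f j)}}

theorem extRel_map_QQ {P : Type*} {rP : P → P → Prop} {Q : Set P} :
    ∀ ⦃a b : Option ↥Q⦄,
      extRel (fun x y : ↥Q => rP x y) Set.univ a b →
        extRel rP Q (Option.map Subtype.val a) (Option.map Subtype.val b) := by
  intro a b h
  match a, b with
  | none, some b => exact b.2
  | some a, some b => exact h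
  | none, none => exact h.elim
  | some _, none => exact h.elim

theorem extRel_optionMap {P : Type*} {rP : P → P → Prop} {Q : Set P} {f : P → P}
    (hf : ∀ ⦃a b⦄, rP a b → rP (f a) (f b)) (hfQ : ∀ ⦃q⦄, q ∈ Q → f q ∈ Q) :
    ∀ ⦃a b : Option P⦄, extRel rP Q a b → extRel rP Q (Option.map f a) (Option.map f b) := by
  intro a b h
  match a, b with
  | none, some b => exact hfQ h
  | some a, some b => exact hf h
  | none, none => exact h.elim
  | some _, none => exact h.elim

theorem suspRel_map {R : Type*} {rR : R → R → Prop} {f : R → R}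
    (hf : ∀ ⦃a b⦄, rR a b → rR (f a) (f b)) :
    ∀ ⦃a b : Bool ⊕ R⦄, suspRel rR a b → suspRel rR (Sum.map id f a) (Sum.map id f b) := by
  intro a b h
  match a, b with
  | Sum.inl x, Sum.inr b => trivial
  | Sum.inr a, Sum.inr b => exact hf h
  | Sum.inl x, Sum.inl y => exact h.elim
  | Sum.inr a, Sum.inl y => exact h.elim

theorem wRel_map {T : Type*} {R : T → Type*} {r : ∀ t, R t → R t → Prop}
    (fT : T → T) (fR : ∀ t, R t → R (fT t))
    (hf : ∀ (t : T) ⦃a b : R t⦄, r t a b → r (fT t) (fR t a) (fR t b)) :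
    ∀ ⦃a b : WedgeP T R⦄, wRel r a b →
      wRel r (Option.map (Sum.map fT (fun p => ⟨fT p.1, fR p.1 p.2⟩)) a)
        (Option.map (Sum.map fT (fun p => ⟨fT p.1, fR p.1 p.2⟩)) b) := by
  rintro (_ | (t | ⟨t, x⟩)) (_ | (t' | ⟨t', y⟩)) h <;> try exact h.elim
  · trivial
  · exact congrArg fT h
  · obtain ⟨ht, hr⟩ := h
    dsimp only at ht hr
    subst ht
    exact ⟨rfl, hf t hr⟩

end PosetConstructions

section ReflectionGroups

/-- The `ζ`-eigenspace `V(x, ζ)` of `x ∈ GL(V)` acting on `V = ℂⁿ`. -/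
noncomputable def eigSp {n : ℕ} (x : Matrix.GeneralLinearGroup (Fin n) ℂ) (ζ : ℂ) :
    Submodule ℂ (Fin n → ℂ) :=
  Module.End.eigenspace (Matrix.toLin' (x : Matrix (Fin n) (Fin n) ℂ)) ζ

/-- The fixed subspace of `g`. -/
noncomputable def fixSp {n : ℕ} (g : Matrix.GeneralLinearGroup (Fin n) ℂ) :
    Submodule ℂ (Fin n → ℂ) := eigSp g 1

/-- A reflection: a non-identity element whose fixed subspace is a hyperplane. -/
def IsReflection {n : ℕ} (g : Matrix.GeneralLinearGroup (Fin n) ℂ) : Prop :=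
  g ≠ 1 ∧ Module.finrank ℂ (fixSp g) = n - 1

/-- A (finite) unitary reflection group in `V = ℂⁿ`. -/
def IsUnitaryReflectionGroup {n : ℕ} (G : Subgroup (Matrix.GeneralLinearGroup (Fin n) ℂ)) :
    Prop :=
  (G : Set (Matrix.GeneralLinearGroup (Fin n) ℂ)).Finite ∧
  (∀ g ∈ G, (g : Matrix (Fin n) (Fin n) ℂ) ∈ Matrix.unitaryGroup (Fin n) ℂ) ∧
  Subgroup.closure {g | g ∈ G ∧ IsReflection g} = G

/-- `γ` normalises `G`. -/
def Normalises {n : ℕ} (γ : Matrix.GeneralLinearGroup (Fin n) ℂ)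
    (G : Subgroup (Matrix.GeneralLinearGroup (Fin n) ℂ)) : Prop :=
  ∀ g, g ∈ G ↔ γ * g * γ⁻¹ ∈ G

/-- The poset `S_ζ^V(γG)` of `ζ`-eigenspaces of elements of the reflection coset `γG`,
to be ordered by the *reverse* of inclusion. -/
def Sset {n : ℕ} (γ : Matrix.GeneralLinearGroup (Fin n) ℂ)
    (G : Subgroup (Matrix.GeneralLinearGroup (Fin n) ℂ)) (ζ : ℂ) :
    Set (Submodule ℂ (Fin n → ℂ)) :=
  {E | ∃ g ∈ G, E = eigSp (γ * g) ζ}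

/-- `S'_ζ^V(γG)`: `S_ζ^V(γG)` with the unique maximal element `1̂` (the smallest eigenspace)
removed. -/
def Sp {n : ℕ} (γ : Matrix.GeneralLinearGroup (Fin n) ℂ)
    (G : Subgroup (Matrix.GeneralLinearGroup (Fin n) ℂ)) (ζ : ℂ) :
    Set (Submodule ℂ (Fin n → ℂ)) :=
  {E ∈ Sset γ G ζ | ∃ F ∈ Sset γ G ζ, ¬ E ≤ F}

/-- `S̃_ζ^V(γG)`: `S_ζ^V(γG)` with the unique maximal element removed, and the unique
minimal element removed if it exists. -/
def Stilde {n : ℕ} (γ : Matrix.GeneralLinearGroup (Fin n) ℂ)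
    (G : Subgroup (Matrix.GeneralLinearGroup (Fin n) ℂ)) (ζ : ℂ) :
    Set (Submodule ℂ (Fin n → ℂ)) :=
  {E ∈ Sset γ G ζ | (∃ F ∈ Sset γ G ζ, ¬ E ≤ F) ∧ (∃ F ∈ Sset γ G ζ, ¬ F ≤ E)}

/-- `T'_ζ^V(γG)`: the non-maximal eigenspaces of `S'_ζ^V(γG)`. -/
def Tp {n : ℕ} (γ : Matrix.GeneralLinearGroup (Fin n) ℂ)
    (G : Subgroup (Matrix.GeneralLinearGroup (Fin n) ℂ)) (ζ : ℂ) :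
    Set (Submodule ℂ (Fin n → ℂ)) :=
  {E ∈ Sp γ G ζ | ∃ F ∈ Sp γ G ζ, E < F}

/-- The set of maximal eigenspaces, `M = S' \ T'`. -/
def Mp {n : ℕ} (γ : Matrix.GeneralLinearGroup (Fin n) ℂ)
    (G : Subgroup (Matrix.GeneralLinearGroup (Fin n) ℂ)) (ζ : ℂ) :
    Set (Submodule ℂ (Fin n → ℂ)) :=
  {E ∈ Sp γ G ζ | ∀ F ∈ Sp γ G ζ, ¬ E < F}

/-- The strict order of `S'_ζ^V(γG)` (reverse inclusion). -/
def rSp {n : ℕ} (γ : Matrix.GeneralLinearGroup (Fin n) ℂ)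
    (G : Subgroup (Matrix.GeneralLinearGroup (Fin n) ℂ)) (ζ : ℂ) :
    ↥(Sp γ G ζ) → ↥(Sp γ G ζ) → Prop :=
  fun E F => F.1 < E.1

/-- The strict order of `U'_ζ^V(γG)` on `Option ↥(S'_ζ^V(γG))`, where `none` is the adjoined
element `0̂_S` lying below exactly the elements of `T'_ζ^V(γG)`. -/
def Urel {n : ℕ} (γ : Matrix.GeneralLinearGroup (Fin n) ℂ)
    (G : Subgroup (Matrix.GeneralLinearGroup (Fin n) ℂ)) (ζ : ℂ) :
    Option ↥(Sp γ G ζ) → Option ↥(Sp γ G ζ) → Prop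
  | some E, some F => F.1 < E.1
  | none, some F => F.1 ∈ Tp γ G ζ
  | _, none => False

end ReflectionGroups

/-- The matrix of an element of a subgroup of `GL(n, ℂ)`. -/
noncomputable abbrev matOf {n : ℕ} {G : Subgroup (Matrix.GeneralLinearGroup (Fin n) ℂ)}
    (g : ↥G) : Matrix (Fin n) (Fin n) ℂ :=
  ((g : Matrix.GeneralLinearGroup (Fin n) ℂ) : Matrix (Fin n) (Fin n) ℂ)

/-- The subset of `↥(S'_ζᵛ(γG))` corresponding to `T'_ζᵛ(γG)`. -/
def TpSub {n : ℕ} (γ : Matrix.GeneralLinearGroup (Fin n) ℂ)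
    (G : Subgroup (Matrix.GeneralLinearGroup (Fin n) ℂ)) (ζ : ℂ) : Set ↥(Sp γ G ζ) :=
  {E : ↥(Sp γ G ζ) | (E : Submodule ℂ (Fin n → ℂ)) ∈ Tp γ G ζ}

/-- Chains of `Q_Q = T' ∪ {0̂}` map to chains of `U'`. -/
theorem UQQ_map {n : ℕ} (γ : Matrix.GeneralLinearGroup (Fin n) ℂ)
    (G : Subgroup (Matrix.GeneralLinearGroup (Fin n) ℂ)) (ζ : ℂ) :
    ∀ ⦃a b : Option ↥(TpSub γ G ζ)⦄,
      extRel (fun x y : ↥(TpSub γ G ζ) => rSp γ G ζ x.1 y.1) Set.univ a b →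
        Urel γ G ζ (Option.map Subtype.val a) (Option.map Subtype.val b) := by
  intro a b h
  match a, b with
  | none, some b => exact b.2
  | some a, some b => exact h
  | none, none => exact h.elim
  | some _, none => exact h.elim

section ConeExtension

variable {α β δ : Type*} {rα : α → α → Prop} {rβ : β → β → Prop} {rδ : δ → δ → Prop}

theorem cmapL_single (f : α → β) (hf : ∀ ⦃a b⦄, rα a b → rβ (f a) (f b)) {n : ℕ}
    (c : OCh α rα n) (k : ℤ) :
    cmapL f hf n (Finsupp.single c k) = Finsupp.single (cmap f hf c) k := by
  simp [cmapL, Finsupp.lmapDomain_apply, Finsupp.mapDomain_single]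

theorem coneL_single (f : α → β) (hf : ∀ ⦃a b⦄, rα a b → rβ (f a) (f b)) (b : β)
    (hb : ∀ a : α, rβ b (f a)) {n : ℕ} (c : OCh α rα n) (k : ℤ) :
    coneL f hf b hb n (Finsupp.single c k) = Finsupp.single (coneMap f hf b hb c) k := by
  simp [coneL, Finsupp.lmapDomain_apply, Finsupp.mapDomain_single]

theorem redH_mk_eq_zero {n : ℕ} (z : cyc α rα n) :
    (Submodule.Quotient.mk z : redH α rα n) = 0 ↔ z.1 ∈ bdries α rα n :=
  Submodule.Quotient.mk_eq_zero _

theorem bdry_cmapL_apply (f : α → β) (hf : ∀ ⦃a b⦄, rα a b → rβ (f a) (f b)) (n : ℕ)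
    (z : ACh α rα (n + 1)) :
    bdry β rβ n (cmapL f hf (n + 1) z) = cmapL f hf n (bdry α rα n z) :=
  LinearMap.congr_fun (bdry_cmapL f hf n) z

theorem cmapL_cmapL (f : α → β) (hf : ∀ ⦃a b⦄, rα a b → rβ (f a) (f b))
    (g : β → δ) (hg : ∀ ⦃a b⦄, rβ a b → rδ (g a) (g b))
    (k : α → δ) (hk : ∀ ⦃a b⦄, rα a b → rδ (k a) (k b)) (hgf : ∀ a, g (f a) = k a) (n : ℕ)
    (z : ACh α rα n) :
    cmapL g hg n (cmapL f hf n z) = cmapL k hk n z := by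
  obtain rfl : g ∘ f = k := funext hgf
  simp only [cmapL, Finsupp.lmapDomain_apply, ← Finsupp.mapDomain_comp]
  rfl

/-- Maps of posets with cone points, sending the cone point to the cone point,
commute with coning. -/
theorem cmapL_coneL {α' β' : Type*} {rα' : α' → α' → Prop} {rβ' : β' → β' → Prop}
    (f : α → β) (hf : ∀ ⦃a b⦄, rα a b → rβ (f a) (f b)) (b : β) (hb : ∀ a : α, rβ b (f a))
    (f' : α' → β') (hf' : ∀ ⦃a b⦄, rα' a b → rβ' (f' a) (f' b)) (b' : β')
    (hb' : ∀ a : α', rβ' b' (f' a))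
    (g : α → α') (hg : ∀ ⦃a b⦄, rα a b → rα' (g a) (g b))
    (h : β → β') (hh : ∀ ⦃a b⦄, rβ a b → rβ' (h a) (h b))
    (hbb : h b = b') (hfg : ∀ a, h (f a) = f' (g a)) (n : ℕ) (z : ACh α rα n) :
    cmapL h hh (n + 1) (coneL f hf b hb n z) = coneL f' hf' b' hb' n (cmapL g hg n z) := by
  simp only [cmapL, coneL, Finsupp.lmapDomain_apply, ← Finsupp.mapDomain_comp]
  congr 1
  funext c
  apply Subtype.ext
  funext i
  refine Fin.cases ?_ (fun i => ?_) i
  · simpa [cmap, coneMap] using hbb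
  · simpa [cmap, coneMap] using hfg _

theorem face_coneMap_zero (f : α → β) (hf : ∀ ⦃a b⦄, rα a b → rβ (f a) (f b)) (b : β)
    (hb : ∀ a : α, rβ b (f a)) {n : ℕ} (c : OCh α rα n) :
    (coneMap f hf b hb c).face 0 = cmap f hf c := by
  apply Subtype.ext
  funext i
  simp [OCh.face, coneMap, cmap]

theorem face_coneMap_succ (f : α → β) (hf : ∀ ⦃a b⦄, rα a b → rβ (f a) (f b)) (b : β)
    (hb : ∀ a : α, rβ b (f a)) {n : ℕ} (c : OCh α rα (n + 1)) (i : Fin (n + 1)) :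
    (coneMap f hf b hb c).face i.succ = coneMap f hf b hb (c.face i) := by
  apply Subtype.ext
  funext k
  refine Fin.cases ?_ (fun k => ?_) k <;> simp [OCh.face, coneMap, Fin.removeNth]

/-- The boundary of a cone. -/
theorem bdry_coneL (f : α → β) (hf : ∀ ⦃a b⦄, rα a b → rβ (f a) (f b)) (b : β)
    (hb : ∀ a : α, rβ b (f a)) (n : ℕ) (z : ACh α rα (n + 1)) :
    bdry β rβ (n + 1) (coneL f hf b hb (n + 1) z) =
      cmapL f hf (n + 1) z - coneL f hf b hb n (bdry α rα n z) := by
  suffices h : (bdry β rβ (n + 1)).comp (coneL f hf b hb (n + 1)) =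
      cmapL f hf (n + 1) - (coneL f hf b hb n).comp (bdry α rα n) from LinearMap.congr_fun h z
  refine Finsupp.lhom_ext fun c k => ?_
  simp only [LinearMap.comp_apply, LinearMap.sub_apply, coneL_single, cmapL_single, bdry_single,
    map_smul, map_sum]
  rw [Fin.sum_univ_succ]
  simp only [face_coneMap_zero, face_coneMap_succ, Fin.val_zero, Fin.val_succ, pow_succ, pow_zero,
    one_smul, mul_neg, mul_one, neg_smul, Finset.sum_neg_distrib, smul_add, smul_neg,
    Finsupp.smul_single, smul_eq_mul, sub_eq_add_neg]

theorem cmap_injective (f : α → β) (hf : ∀ ⦃a b⦄, rα a b → rβ (f a) (f b))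
    (hinj : Function.Injective f) (n : ℕ) :
    Function.Injective (cmap (rα := rα) (rβ := rβ) f hf (n := n)) := fun _ _ h =>
  Subtype.ext (hinj.comp_left (congrArg Subtype.val h))

theorem cmapL_injective (f : α → β) (hf : ∀ ⦃a b⦄, rα a b → rβ (f a) (f b))
    (hinj : Function.Injective f) (n : ℕ) :
    Function.Injective (cmapL (rα := rα) (rβ := rβ) f hf n) :=
  Finsupp.mapDomain_injective (cmap_injective f hf hinj n)

theorem coneMap_injective (f : α → β) (hf : ∀ ⦃a b⦄, rα a b → rβ (f a) (f b)) (b : β)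
    (hb : ∀ a : α, rβ b (f a)) (hinj : Function.Injective f) (n : ℕ) :
    Function.Injective (coneMap (rα := rα) (rβ := rβ) f hf b hb (n := n)) := fun _ _ h =>
  Subtype.ext (hinj.comp_left (Fin.cons_right_injective (α := fun _ => β) b
    (congrArg Subtype.val h)))

/-- The relation `rU` on `Option P` extends `rP` by a bottom element `none` lying below exactly
the elements of the image of the embedding `j` of `(Q, rQ)` into `(P, rP)`. -/
structure IsConeExtension {Q P : Type*} (rQ : Q → Q → Prop) (rP : P → P → Prop) (j : Q → P)
    (rU : Option P → Option P → Prop) : Prop where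
  inj : Function.Injective j
  map_iff : ∀ a b, rP (j a) (j b) ↔ rQ a b
  some_iff : ∀ a b, rU (some a) (some b) ↔ rP a b
  none_iff : ∀ x, rU none (some x) ↔ ∃ q, j q = x
  not_none : ∀ x, ¬ rU x none

namespace IsConeExtension

variable {Q P : Type*} {rQ : Q → Q → Prop} {rP : P → P → Prop} {j : Q → P}
  {rU : Option P → Option P → Prop} (H : IsConeExtension rQ rP j rU)

include H

theorem mono_j : ∀ ⦃a b⦄, rQ a b → rP (j a) (j b) := fun a b => (H.map_iff a b).2

theorem mono_some : ∀ ⦃a b⦄, rP a b → rU (some a) (some b) := fun a b => (H.some_iff a b).2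

theorem mono_some_j : ∀ ⦃a b⦄, rQ a b → rU (some (j a)) (some (j b)) :=
  fun _ _ h => H.mono_some (H.mono_j h)

theorem none_rel (q : Q) : rU none (some (j q)) := (H.none_iff _).2 ⟨q, rfl⟩

/-- The chain map induced by the embedding of `Q` into `P`. -/
noncomputable def incl (n : ℕ) : ACh Q rQ n →ₗ[ℤ] ACh P rP n := cmapL j H.mono_j n

/-- The chain map induced by `some : P → Option P`. -/
noncomputable def emb (n : ℕ) : ACh P rP n →ₗ[ℤ] ACh (Option P) rU n := cmapL some H.mono_some n

/-- Coning chains of `Q` off with the adjoined element. -/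
noncomputable def cone (n : ℕ) : ACh Q rQ n →ₗ[ℤ] ACh (Option P) rU (n + 1) :=
  coneL (fun q => some (j q)) H.mono_some_j none H.none_rel n

theorem injective_some_j : Function.Injective fun q => some (j q) :=
  (Option.some_injective P).comp H.inj

/-- The linear projection onto chains of `Q`, extracting the coefficients of the cones. -/
noncomputable def link (n : ℕ) : ACh (Option P) rU (n + 1) →ₗ[ℤ] ACh Q rQ n :=
  Finsupp.lcomapDomain _ (coneMap_injective (fun q => some (j q)) H.mono_some_j none H.none_rel
    H.injective_some_j n)

theorem exists_cmap_or_coneMap {n : ℕ} (c : OCh (Option P) rU (n + 1)) :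
    (∃ d : OCh P rP (n + 1), cmap some H.mono_some d = c) ∨
    ∃ d : OCh Q rQ n, coneMap (fun q => some (j q)) H.mono_some_j none H.none_rel d = c := by
  have hsucc : ∀ i : Fin n, ∃ x, c.1 i.succ = some x := fun i => by
    rcases hx : c.1 i.succ with _ | x
    · have := c.2 (Fin.succ_pos i)
      rw [hx] at this
      exact (H.not_none _ this).elim
    · exact ⟨x, rfl⟩
  rcases h0 : c.1 0 with _ | x0
  · right
    have hq : ∀ i : Fin n, ∃ q, c.1 i.succ = some (j q) := fun i => by
      obtain ⟨x, hx⟩ := hsucc i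
      have := c.2 (Fin.succ_pos i)
      rw [hx, h0] at this
      obtain ⟨q, rfl⟩ := (H.none_iff x).1 this
      exact ⟨q, hx⟩
    choose q hq using hq
    refine ⟨⟨q, fun i k hik => ?_⟩, Subtype.ext (funext fun i => ?_)⟩
    · have := c.2 (Fin.succ_lt_succ_iff.2 hik)
      rwa [hq, hq, H.some_iff, H.map_iff] at this
    · refine Fin.cases ?_ (fun i => ?_) i
      · simp [coneMap, h0]
      · simp [coneMap, hq]
  · left
    have hx : ∀ i : Fin (n + 1), ∃ x, c.1 i = some x := Fin.cases ⟨x0, h0⟩ hsucc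
    choose x hx using hx
    refine ⟨⟨x, fun i k hik => ?_⟩, Subtype.ext (funext fun i => (hx i).symm)⟩
    have := c.2 hik
    rwa [hx, hx, H.some_iff] at this

theorem link_cone (n : ℕ) (t : ACh Q rQ n) : H.link n (H.cone n t) = t :=
  Finsupp.comapDomain_mapDomain _ (coneMap_injective (fun q => some (j q)) H.mono_some_j none
    H.none_rel H.injective_some_j n) t

theorem link_emb (n : ℕ) (a : ACh P rP (n + 1)) : H.link n (H.emb (n + 1) a) = 0 := by
  ext c
  change Finsupp.mapDomain _ a _ = 0
  refine Finsupp.mapDomain_of_notMem_range _ _ ?_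
  rintro ⟨d, hd⟩
  have := congrFun (congrArg Subtype.val hd) 0
  simp [cmap, coneMap] at this

theorem exists_eq_emb_add_cone (n : ℕ) (u : ACh (Option P) rU (n + 1)) :
    ∃ s t, u = H.emb (n + 1) s + H.cone n t := by
  induction u using Finsupp.induction_linear with
  | zero => exact ⟨0, 0, by simp⟩
  | add u v hu hv =>
    obtain ⟨s, t, rfl⟩ := hu
    obtain ⟨s', t', rfl⟩ := hv
    exact ⟨s + s', t + t', by simp only [map_add]; abel⟩
  | single c k =>
    rcases H.exists_cmap_or_coneMap c with ⟨d, rfl⟩ | ⟨d, rfl⟩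
    · exact ⟨Finsupp.single d k, 0, by rw [map_zero, add_zero, emb, cmapL_single]⟩
    · exact ⟨0, Finsupp.single d k, by rw [map_zero, zero_add, cone, coneL_single]⟩

theorem emb_injective (n : ℕ) : Function.Injective (H.emb n) :=
  cmapL_injective _ _ (Option.some_injective P) n

theorem incl_injective (n : ℕ) : Function.Injective (H.incl n) :=
  cmapL_injective _ _ H.inj n

theorem emb_add_cone_eq_zero {n : ℕ} {s : ACh P rP (n + 1)} {t : ACh Q rQ n} :
    H.emb (n + 1) s + H.cone n t = 0 ↔ s = 0 ∧ t = 0 := by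
  constructor
  · intro h
    have ht : t = 0 := by simpa [link_emb, link_cone] using congrArg (H.link n) h
    subst ht
    exact ⟨H.emb_injective _ (by simpa using h), rfl⟩
  · rintro ⟨rfl, rfl⟩
    simp

theorem bdry_incl (n : ℕ) (t : ACh Q rQ (n + 1)) :
    bdry P rP n (H.incl (n + 1) t) = H.incl n (bdry Q rQ n t) := bdry_cmapL_apply _ _ _ _

theorem bdry_emb (n : ℕ) (t : ACh P rP (n + 1)) :
    bdry (Option P) rU n (H.emb (n + 1) t) = H.emb n (bdry P rP n t) := bdry_cmapL_apply _ _ _ _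

theorem bdry_emb_add_cone (n : ℕ) (s : ACh P rP (n + 2)) (t : ACh Q rQ (n + 1)) :
    bdry (Option P) rU (n + 1) (H.emb (n + 2) s + H.cone (n + 1) t) =
      H.emb (n + 1) (bdry P rP (n + 1) s + H.incl (n + 1) t) + H.cone n (- bdry Q rQ n t) := by
  have h : H.emb (n + 1) (H.incl (n + 1) t) =
      cmapL (fun q => some (j q)) H.mono_some_j (n + 1) t :=
    cmapL_cmapL _ _ _ _ _ _ (fun _ => rfl) _ _
  rw [map_add, map_add, map_neg, bdry_emb, h, cone, bdry_coneL]
  simp only [cone]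
  abel

theorem emb_add_cone_mem_cyc {n : ℕ} {s : ACh P rP (n + 2)} {t : ACh Q rQ (n + 1)} :
    H.emb (n + 2) s + H.cone (n + 1) t ∈ cyc (Option P) rU (n + 1) ↔
      bdry P rP (n + 1) s + H.incl (n + 1) t = 0 ∧ bdry Q rQ n t = 0 := by
  rw [cyc, LinearMap.mem_ker, bdry_emb_add_cone, emb_add_cone_eq_zero, neg_eq_zero]

theorem bdry_link (n : ℕ) (u : ACh (Option P) rU (n + 2)) :
    bdry Q rQ n (H.link (n + 1) u) = - H.link n (bdry (Option P) rU (n + 1) u) := by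
  obtain ⟨s, t, rfl⟩ := H.exists_eq_emb_add_cone _ u
  rw [bdry_emb_add_cone]
  simp [link_emb, link_cone]

theorem neg_link_mem_cyc {m : ℕ} {u : ACh (Option P) rU (m + 2)}
    (hu : u ∈ cyc (Option P) rU (m + 1)) : (-H.link (m + 1)) u ∈ cyc Q rQ m := by
  rw [cyc, LinearMap.mem_ker] at hu ⊢
  rw [LinearMap.neg_apply, map_neg, bdry_link, hu, map_zero, neg_zero, neg_zero]

/-- The connecting map in reduced homology: minus the map induced by `link`. -/
noncomputable def connect (m : ℕ) : redH (Option P) rU (m + 1) →ₗ[ℤ] redH Q rQ m :=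
  Submodule.mapQ _ _
    ((-H.link (m + 1)).restrict (p := cyc (Option P) rU (m + 1)) (q := cyc Q rQ m)
      fun _ hu => H.neg_link_mem_cyc hu)
    (by
      rintro ⟨u, hu⟩ ⟨v, hv⟩
      refine ⟨H.link (m + 2) v, ?_⟩
      rw [bdry_link, hv]
      rfl)

theorem connect_mk (m : ℕ) (s : ACh P rP (m + 2)) (t : ACh Q rQ (m + 1))
    (hz : H.emb (m + 2) s + H.cone (m + 1) t ∈ cyc (Option P) rU (m + 1))
    (w : ACh Q rQ (m + 1)) (hw : w ∈ cyc Q rQ m) (hwt : w + t ∈ bdries Q rQ m) :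
    H.connect m (Submodule.Quotient.mk ⟨_, hz⟩) = Submodule.Quotient.mk ⟨w, hw⟩ := by
  refine ((Submodule.Quotient.eq _).2 ?_).symm
  change w - -(H.link (m + 1) (H.emb (m + 2) s + H.cone (m + 1) t)) ∈ bdries Q rQ m
  rwa [map_add, link_emb, link_cone, zero_add, sub_neg_eq_add]

theorem exact_incl_emb (m : ℕ) :
    Function.Exact (indH j H.mono_j m) (indH some H.mono_some m) := by
  intro x
  obtain ⟨⟨a, ha⟩, rfl⟩ := Submodule.Quotient.mk_surjective _ x
  constructor
  · intro h
    obtain ⟨u, hu⟩ : H.emb (m + 1) a ∈ bdries (Option P) rU m :=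
      (redH_mk_eq_zero ⟨_, cmapL_mem_cyc some H.mono_some ha⟩).1 h
    obtain ⟨s, t, rfl⟩ := H.exists_eq_emb_add_cone _ u
    have h0 : H.emb (m + 1) (bdry P rP (m + 1) s + H.incl (m + 1) t - a) +
        H.cone m (-bdry Q rQ m t) = 0 := by
      rw [bdry_emb_add_cone] at hu
      rw [map_sub, ← hu]
      abel
    obtain ⟨hs, ht⟩ := H.emb_add_cone_eq_zero.1 h0
    refine ⟨Submodule.Quotient.mk ⟨t, neg_eq_zero.1 ht⟩, (Submodule.Quotient.eq _).2 ?_⟩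
    refine ⟨-s, ?_⟩
    change bdry P rP (m + 1) (-s) = H.incl (m + 1) t - a
    rw [map_neg, neg_eq_iff_add_eq_zero, ← hs]
    abel
  · rintro ⟨y, hy⟩
    obtain ⟨⟨t, ht⟩, rfl⟩ := Submodule.Quotient.mk_surjective _ y
    rw [← hy]
    refine (Submodule.Quotient.mk_eq_zero _).2 ⟨H.cone (m + 1) t, ?_⟩
    have := H.bdry_emb_add_cone m 0 t
    rw [cyc, LinearMap.mem_ker] at ht
    simpa [ht, emb, incl] using this

theorem exact_emb_connect (m : ℕ) :
    Function.Exact (indH some H.mono_some (m + 1)) (H.connect m) := by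
  intro x
  constructor
  · obtain ⟨⟨u, hu⟩, rfl⟩ := Submodule.Quotient.mk_surjective _ x
    intro h
    obtain ⟨w, hw⟩ : -H.link (m + 1) u ∈ bdries Q rQ m :=
      (redH_mk_eq_zero ⟨_, H.neg_link_mem_cyc hu⟩).1 h
    obtain ⟨s, t, rfl⟩ := H.exists_eq_emb_add_cone _ u
    rw [map_add, link_emb, link_cone, zero_add] at hw
    obtain ⟨hs, -⟩ := H.emb_add_cone_mem_cyc.1 hu
    refine ⟨Submodule.Quotient.mk ⟨s - H.incl (m + 2) w, ?_⟩, (Submodule.Quotient.eq _).2 ?_⟩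
    · rw [cyc, LinearMap.mem_ker, map_sub, bdry_incl, hw, map_neg, sub_neg_eq_add, hs]
    · refine ⟨-H.cone (m + 2) w, ?_⟩
      have := H.bdry_emb_add_cone (m + 1) 0 w
      rw [hw, map_zero, map_zero, zero_add, zero_add, neg_neg] at this
      change _ = H.emb (m + 2) (s - H.incl (m + 2) w) - (H.emb (m + 2) s + H.cone (m + 1) t)
      rw [map_neg, this, map_sub]
      abel
  · rintro ⟨y, rfl⟩
    obtain ⟨⟨s, hs⟩, rfl⟩ := Submodule.Quotient.mk_surjective _ y
    refine (Submodule.Quotient.mk_eq_zero _).2 ?_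
    change -H.link (m + 1) (H.emb (m + 2) s) ∈ bdries Q rQ m
    rw [link_emb, neg_zero]
    exact zero_mem _

theorem exact_connect_incl (m : ℕ) :
    Function.Exact (H.connect m) (indH j H.mono_j m) := by
  intro x
  constructor
  · obtain ⟨⟨w, hw⟩, rfl⟩ := Submodule.Quotient.mk_surjective _ x
    intro h
    obtain ⟨a, ha⟩ : H.incl (m + 1) w ∈ bdries P rP m :=
      (redH_mk_eq_zero ⟨_, cmapL_mem_cyc j H.mono_j hw⟩).1 h
    have hz : H.emb (m + 2) a + H.cone (m + 1) (-w) ∈ cyc (Option P) rU (m + 1) :=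
      H.emb_add_cone_mem_cyc.2 ⟨by rw [ha, map_neg, add_neg_cancel],
        by rw [map_neg, LinearMap.mem_ker.1 hw, neg_zero]⟩
    refine ⟨Submodule.Quotient.mk ⟨_, hz⟩, H.connect_mk m _ _ hz w hw ?_⟩
    rw [add_neg_cancel]
    exact zero_mem _
  · rintro ⟨y, rfl⟩
    obtain ⟨⟨u, hu⟩, rfl⟩ := Submodule.Quotient.mk_surjective _ y
    obtain ⟨s, t, rfl⟩ := H.exists_eq_emb_add_cone _ u
    obtain ⟨hs, -⟩ := H.emb_add_cone_mem_cyc.1 hu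
    refine (Submodule.Quotient.mk_eq_zero _).2 ⟨s, ?_⟩
    change _ = H.incl (m + 1) (-H.link (m + 1) (H.emb (m + 2) s + H.cone (m + 1) t))
    rw [map_add, link_emb, link_cone, zero_add, map_neg]
    exact eq_neg_of_add_eq_zero_left hs

/-- The connecting map is the Mayer–Vietoris map: it sends the class of `a + b`, with `a` a chain
of `P` and `b` a chain of the cone over `Q`, to the class of `∂ a`. -/
theorem connect_add {rV : Option Q → Option Q → Prop} (HV : IsConeExtension rQ rQ id rV)
    (hV : ∀ ⦃a b⦄, rV a b → rU (Option.map j a) (Option.map j b)) (m : ℕ)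
    (a : ACh P rP (m + 2)) (b : ACh (Option Q) rV (m + 2))
    (hz : cmapL some H.mono_some (m + 2) a + cmapL (Option.map j) hV (m + 2) b ∈
      cyc (Option P) rU (m + 1))
    (w : ACh Q rQ (m + 1)) (hw : w ∈ cyc Q rQ m)
    (hwa : cmapL j H.mono_j (m + 1) w = bdry P rP (m + 1) a) :
    H.connect m (Submodule.Quotient.mk ⟨_, hz⟩) = Submodule.Quotient.mk ⟨w, hw⟩ := by
  obtain ⟨s, t, rfl⟩ := HV.exists_eq_emb_add_cone _ b
  have hs : cmapL (Option.map j) hV (m + 2) (HV.emb (m + 2) s) =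
      H.emb (m + 2) (H.incl (m + 2) s) := by
    have h : H.emb (m + 2) (H.incl (m + 2) s) = _ :=
      cmapL_cmapL _ _ _ _ _ H.mono_some_j (fun _ => rfl) _ _
    rw [h]
    exact cmapL_cmapL _ _ _ _ _ _ (fun _ => rfl) _ _
  have ht : cmapL (Option.map j) hV (m + 2) (HV.cone (m + 1) t) = H.cone (m + 1) t := by
    have hid : cmapL (rα := rQ) (rβ := rQ) id (fun _ _ h => h) (m + 1) t = t :=
      Finsupp.mapDomain_id
    rw [cone, cmapL_coneL _ _ _ _ (fun q => some (j q)) H.mono_some_j none H.none_rel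
      id (fun _ _ h => h) _ hV rfl (fun _ => rfl), hid, cone]
  have hu : cmapL some H.mono_some (m + 2) a +
      cmapL (Option.map j) hV (m + 2) (HV.emb (m + 2) s + HV.cone (m + 1) t) =
      H.emb (m + 2) (a + H.incl (m + 2) s) + H.cone (m + 1) t := by
    rw [map_add, hs, ht, map_add]
    exact (add_assoc _ _ _).symm
  have hz' := hz
  rw [hu] at hz'
  have h0 := (H.emb_add_cone_mem_cyc.1 hz').1
  rw [map_add, ← hwa, bdry_incl] at h0
  change H.incl (m + 1) w + _ + _ = 0 at h0
  rw [← map_add, ← map_add] at h0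
  have h1 := H.incl_injective _ (h0.trans (map_zero _).symm)
  have := H.connect_mk m _ t hz' w hw ⟨-s, by
    rw [map_neg, neg_eq_iff_add_eq_zero, ← h1]
    abel⟩
  rw [← this]
  congr 2
  exact Subtype.ext hu

theorem connect_indH (fQ : Q → Q) (hfQ : ∀ ⦃a b⦄, rQ a b → rQ (fQ a) (fQ b)) (fP : P → P)
    (hfP : ∀ ⦃a b⦄, rP a b → rP (fP a) (fP b)) (hPQ : ∀ q, fP (j q) = j (fQ q))
    (fU : Option P → Option P) (hfU : ∀ ⦃a b⦄, rU a b → rU (fU a) (fU b))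
    (hnone : fU none = none) (hsome : ∀ x, fU (some x) = some (fP x)) (m : ℕ)
    (x : redH (Option P) rU (m + 1)) :
    H.connect m (indH fU hfU (m + 1) x) = indH fQ hfQ m (H.connect m x) := by
  obtain ⟨⟨u, hu⟩, rfl⟩ := Submodule.Quotient.mk_surjective _ x
  refine congrArg Submodule.Quotient.mk (Subtype.ext ?_)
  change -H.link (m + 1) (cmapL fU hfU (m + 2) u) = cmapL fQ hfQ (m + 1) (-H.link (m + 1) u)
  obtain ⟨s, t, rfl⟩ := H.exists_eq_emb_add_cone _ u
  have hs : cmapL fU hfU (m + 2) (H.emb (m + 2) s) = H.emb (m + 2) (cmapL fP hfP (m + 2) s) := by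
    rw [emb, cmapL_cmapL _ _ _ _ _ (fun _ _ h => H.mono_some (hfP h)) hsome,
      cmapL_cmapL _ _ _ _ _ (fun _ _ h => H.mono_some (hfP h)) (fun _ => rfl)]
  have ht : cmapL fU hfU (m + 2) (H.cone (m + 1) t) =
      H.cone (m + 1) (cmapL fQ hfQ (m + 1) t) :=
    cmapL_coneL _ _ _ _ _ _ _ _ _ _ _ _ hnone (fun q => by rw [hsome, hPQ]) _ _
  rw [map_add, hs, ht, map_add, link_emb, link_cone, map_add, link_emb, link_cone, zero_add,
    zero_add, map_neg]

end IsConeExtension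

/-- Commuting squares of relation-preserving maps induce commuting squares in homology. -/
theorem indH_comm {ε : Type*} {rε : ε → ε → Prop}
    (f : α → β) (hf : ∀ ⦃a b⦄, rα a b → rβ (f a) (f b))
    (g : β → δ) (hg : ∀ ⦃a b⦄, rβ a b → rδ (g a) (g b))
    (f' : α → ε) (hf' : ∀ ⦃a b⦄, rα a b → rε (f' a) (f' b))
    (g' : ε → δ) (hg' : ∀ ⦃a b⦄, rε a b → rδ (g' a) (g' b))
    (h : ∀ a, g (f a) = g' (f' a)) (m : ℕ) (x : redH α rα m) :
    indH g hg m (indH f hf m x) = indH g' hg' m (indH f' hf' m x) := by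
  obtain ⟨⟨u, hu⟩, rfl⟩ := Submodule.Quotient.mk_surjective _ x
  refine congrArg Submodule.Quotient.mk (Subtype.ext ?_)
  change cmapL g hg (m + 1) (cmapL f hf (m + 1) u) = cmapL g' hg' (m + 1) (cmapL f' hf' (m + 1) u)
  rw [cmapL_cmapL _ _ _ _ _ (fun _ _ hr => hg (hf hr)) (fun _ => rfl),
    cmapL_cmapL _ _ _ _ _ (fun _ _ hr => hg (hf hr)) (fun a => (h a).symm)]

theorem isConeExtension_Urel {n : ℕ} (γ : Matrix.GeneralLinearGroup (Fin n) ℂ)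
    (G : Subgroup (Matrix.GeneralLinearGroup (Fin n) ℂ)) (ζ : ℂ) :
    IsConeExtension (fun a b : ↥(TpSub γ G ζ) => rSp γ G ζ a.1 b.1) (rSp γ G ζ)
      (Subtype.val : ↥(TpSub γ G ζ) → ↥(Sp γ G ζ)) (Urel γ G ζ) where
  inj := Subtype.val_injective
  map_iff _ _ := Iff.rfl
  some_iff _ _ := Iff.rfl
  none_iff _ := ⟨fun h => ⟨⟨_, h⟩, rfl⟩, fun ⟨q, hq⟩ => hq ▸ q.2⟩
  not_none x h := by cases x <;> exact h

theorem isConeExtension_extRel_univ {Q : Type*} (rQ : Q → Q → Prop) :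
    IsConeExtension rQ rQ id (extRel rQ Set.univ) where
  inj := Function.injective_id
  map_iff _ _ := Iff.rfl
  some_iff _ _ := Iff.rfl
  none_iff x := ⟨fun _ => ⟨x, rfl⟩, fun _ => Set.mem_univ x⟩
  not_none x h := by cases x <;> exact h

end ConeExtension

/-- Theorem 4.2(i).  For a unitary reflection coset `γG` in `V = ℂⁿ` and a
root of unity `ζ` there is a long exact Mayer–Vietoris sequence of `ℤG`-modules
`⋯ → H̃ₘ(T') → H̃ₘ(S') → H̃ₘ(U') → H̃ₘ₋₁(T') → ⋯` for the extension `P = S'_ζᵛ(γG)` of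
`Q = T'_ζᵛ(γG)` with `P_Q = U'_ζᵛ(γG)`, where the first two maps are induced by the
inclusions and the connecting map is given by `r [α + β] = [∂ α]`.  The `G`-action (by
`g • V(x,ζ) = V(gxg⁻¹,ζ)`, i.e. taking images of eigenspaces, fixing `0̂_S`) is realized by
any order-preserving maps `σS`, `σT`, `σU` with those values. -/
theorem statement14 {n : ℕ} (γ : Matrix.GeneralLinearGroup (Fin n) ℂ)
    (G : Subgroup (Matrix.GeneralLinearGroup (Fin n) ℂ))
    (hG : IsUnitaryReflectionGroup G) (hγ : Normalises γ G)
    (ζ : ℂ) (hζ : ∃ m : ℕ, 0 < m ∧ ζ ^ m = 1)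
    (σS : ↥G → ↥(Sp γ G ζ) → ↥(Sp γ G ζ))
    (hσSval : ∀ (g : ↥G) (E : ↥(Sp γ G ζ)),
      (σS g E : Submodule ℂ (Fin n → ℂ)) =
        Submodule.map (Matrix.toLin' (matOf g)) (E : Submodule ℂ (Fin n → ℂ)))
    (hσSmono : ∀ g : ↥G, ∀ ⦃x y⦄, rSp γ G ζ x y → rSp γ G ζ (σS g x) (σS g y))
    (σT : ↥G → ↥(TpSub γ G ζ) → ↥(TpSub γ G ζ))
    (hσTval : ∀ (g : ↥G) (E : ↥(TpSub γ G ζ)), (σT g E).1 = σS g E.1)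
    (hσTmono : ∀ g : ↥G, ∀ ⦃x y : ↥(TpSub γ G ζ)⦄,
      rSp γ G ζ x.1 y.1 → rSp γ G ζ (σT g x).1 (σT g y).1)
    (σU : ↥G → Option ↥(Sp γ G ζ) → Option ↥(Sp γ G ζ))
    (hσUnone : ∀ g, σU g none = none)
    (hσUval : ∀ (g : ↥G) (E : ↥(Sp γ G ζ)), σU g (some E) = some (σS g E))
    (hσUmono : ∀ g : ↥G, ∀ ⦃x y⦄, Urel γ G ζ x y → Urel γ G ζ (σU g x) (σU g y)) :
    ∃ r : ∀ m : ℕ, redH (Option ↥(Sp γ G ζ)) (Urel γ G ζ) (m + 1) →ₗ[ℤ]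
        redH ↥(TpSub γ G ζ) (fun a b : ↥(TpSub γ G ζ) => rSp γ G ζ a.1 b.1) m,
      -- exactness at H̃ₘ(S'):  H̃ₘ(T') → H̃ₘ(S') → H̃ₘ(U')
      (∀ m : ℕ, Function.Exact
        (indH (rα := fun a b : ↥(TpSub γ G ζ) => rSp γ G ζ a.1 b.1) (rβ := rSp γ G ζ)
          (Subtype.val : ↥(TpSub γ G ζ) → ↥(Sp γ G ζ)) (fun _ _ h => h) m)
        (indH (rα := rSp γ G ζ) (rβ := Urel γ G ζ)
          (some : ↥(Sp γ G ζ) → Option ↥(Sp γ G ζ)) (fun _ _ h => h) m)) ∧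
      -- exactness at H̃ₘ₊₁(U'):  H̃ₘ₊₁(S') → H̃ₘ₊₁(U') → H̃ₘ(T')
      (∀ m : ℕ, Function.Exact
        (indH (rα := rSp γ G ζ) (rβ := Urel γ G ζ)
          (some : ↥(Sp γ G ζ) → Option ↥(Sp γ G ζ)) (fun _ _ h => h) (m + 1)) (r m)) ∧
      -- exactness at H̃ₘ(T'):  H̃ₘ₊₁(U') → H̃ₘ(T') → H̃ₘ(S')
      (∀ m : ℕ, Function.Exact (r m)
        (indH (rα := fun a b : ↥(TpSub γ G ζ) => rSp γ G ζ a.1 b.1) (rβ := rSp γ G ζ)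
          (Subtype.val : ↥(TpSub γ G ζ) → ↥(Sp γ G ζ)) (fun _ _ h => h) m)) ∧
      -- the connecting map r is the Mayer–Vietoris map `r [α + β] = [∂ α]`
      (∀ (m : ℕ) (a : ACh ↥(Sp γ G ζ) (rSp γ G ζ) (m + 2))
        (b : ACh (Option ↥(TpSub γ G ζ))
          (extRel (fun x y : ↥(TpSub γ G ζ) => rSp γ G ζ x.1 y.1) Set.univ) (m + 2))
        (hz : cmapL (rα := rSp γ G ζ) (rβ := Urel γ G ζ)
            (some : ↥(Sp γ G ζ) → Option ↥(Sp γ G ζ)) (fun _ _ h => h) (m + 2) a +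
            cmapL (rα := extRel (fun x y : ↥(TpSub γ G ζ) => rSp γ G ζ x.1 y.1) Set.univ)
              (rβ := Urel γ G ζ) (Option.map Subtype.val) (UQQ_map γ G ζ) (m + 2) b ∈
          cyc (Option ↥(Sp γ G ζ)) (Urel γ G ζ) (m + 1))
        (w : ACh ↥(TpSub γ G ζ) (fun x y : ↥(TpSub γ G ζ) => rSp γ G ζ x.1 y.1) (m + 1))
        (hw : w ∈ cyc ↥(TpSub γ G ζ) (fun x y : ↥(TpSub γ G ζ) => rSp γ G ζ x.1 y.1) m),
        cmapL (rα := fun x y : ↥(TpSub γ G ζ) => rSp γ G ζ x.1 y.1) (rβ := rSp γ G ζ)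
            (Subtype.val : ↥(TpSub γ G ζ) → ↥(Sp γ G ζ)) (fun _ _ h => h) (m + 1) w =
          bdry ↥(Sp γ G ζ) (rSp γ G ζ) (m + 1) a →
        r m (Submodule.Quotient.mk ⟨_, hz⟩) = Submodule.Quotient.mk ⟨w, hw⟩) ∧
      -- the maps are G-equivariant
      (∀ (g : ↥G) (m : ℕ)
        (x : redH ↥(TpSub γ G ζ) (fun a b : ↥(TpSub γ G ζ) => rSp γ G ζ a.1 b.1) m),
        indH (rα := fun a b : ↥(TpSub γ G ζ) => rSp γ G ζ a.1 b.1) (rβ := rSp γ G ζ)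
            (Subtype.val : ↥(TpSub γ G ζ) → ↥(Sp γ G ζ)) (fun _ _ h => h) m
            (indH (rα := fun a b : ↥(TpSub γ G ζ) => rSp γ G ζ a.1 b.1)
              (rβ := fun a b : ↥(TpSub γ G ζ) => rSp γ G ζ a.1 b.1)
              (σT g) (fun _ _ h => hσTmono g h) m x) =
          indH (σS g) (hσSmono g) m
            (indH (rα := fun a b : ↥(TpSub γ G ζ) => rSp γ G ζ a.1 b.1) (rβ := rSp γ G ζ)
              (Subtype.val : ↥(TpSub γ G ζ) → ↥(Sp γ G ζ)) (fun _ _ h => h) m x)) ∧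
      (∀ (g : ↥G) (m : ℕ) (x : redH ↥(Sp γ G ζ) (rSp γ G ζ) m),
        indH (rα := rSp γ G ζ) (rβ := Urel γ G ζ)
            (some : ↥(Sp γ G ζ) → Option ↥(Sp γ G ζ)) (fun _ _ h => h) m
            (indH (σS g) (hσSmono g) m x) =
          indH (σU g) (hσUmono g) m
            (indH (rα := rSp γ G ζ) (rβ := Urel γ G ζ)
              (some : ↥(Sp γ G ζ) → Option ↥(Sp γ G ζ)) (fun _ _ h => h) m x)) ∧
      (∀ (g : ↥G) (m : ℕ) (x : redH (Option ↥(Sp γ G ζ)) (Urel γ G ζ) (m + 1)),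
        r m (indH (σU g) (hσUmono g) (m + 1) x) =
          indH (rα := fun a b : ↥(TpSub γ G ζ) => rSp γ G ζ a.1 b.1)
            (rβ := fun a b : ↥(TpSub γ G ζ) => rSp γ G ζ a.1 b.1)
            (σT g) (fun _ _ h => hσTmono g h) m (r m x)) := by
  have H := isConeExtension_Urel γ G ζ
  exact ⟨H.connect, H.exact_incl_emb, H.exact_emb_connect, H.exact_connect_incl,
    H.connect_add (isConeExtension_extRel_univ _) (UQQ_map γ G ζ),
    fun g => indH_comm _ _ _ _ _ _ _ _ (hσTval g),
    fun g => indH_comm _ _ _ _ _ _ _ _ fun E => (hσUval g E).symm,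
    fun g => H.connect_indH _ _ _ (hσSmono g) (fun q => (hσTval g q).symm) _ _ (hσUnone g)
      (hσUval g)⟩
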